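/- Let R be a commutative ring, let Γ be a group, let N be a normal subgroup of Γ, and let V be a left R[Γ]-module such that the group cohomology H^j(N, V) vanishes for all j ≥ 1. Then for every left R[Γ/N]-module W and every i ≥ 0 there is an isomorphism Ext^i_{R[Γ/N]}(W, V^N) ≅ Ext^i_{R[Γ]}(W, V), where on the right-hand side W is regarded as an R[Γ]-module via the quotient map Γ → Γ/N. -/

import Mathlib

open CategoryTheory

theorem AddMonoidHom.nonempty_addEquiv_of_ker_iff {A A' B B' : Type*} [AddCommGroup A]
    [AddCommGroup A'] [AddCommGroup B] [AddCommGroup B'] (φ : A →+ B) (φ' : A' →+ B')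
    (hφ : Function.Surjective φ) (hφ' : Function.Surjective φ') (e : A ≃+ A')
    (h : ∀ a, φ a = 0 ↔ φ' (e a) = 0) : Nonempty (B ≃+ B') := by
  have hker : φ.ker = (φ'.comp e.toAddMonoidHom).ker := by
    ext a
    exact h a
  exact ⟨(QuotientAddGroup.quotientKerEquivOfSurjective φ hφ).symm.trans
    ((QuotientAddGroup.quotientAddEquivOfEq hker).trans
      (QuotientAddGroup.quotientKerEquivOfSurjective (φ'.comp e.toAddMonoidHom)
        (hφ'.comp e.surjective)))⟩

namespace CategoryTheory

open Abelian

theorem ProjectiveResolution.extMk_eq_zero_iff_exists_d {C : Type*} [Category* C] [Abelian C]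
    [HasExt C] {X Y : C} (P : ProjectiveResolution X) {n : ℕ} (f : P.complex.X n ⟶ Y) (m : ℕ)
    (hm : n + 1 = m) (hf : P.complex.d m n ≫ f = 0) :
    P.extMk f m hm hf = 0 ↔
      ∃ g : P.complex.X ((ComplexShape.up ℕ).prev n) ⟶ Y,
        P.complex.d n ((ComplexShape.up ℕ).prev n) ≫ g = f := by
  cases n with
  | succ p =>
    rw [P.extMk_eq_zero_iff f m hm hf p rfl]
    have : (ComplexShape.up ℕ).prev (p + 1) = p := by simp
    rw [this]
  | zero =>
    have hd : P.complex.d 0 ((ComplexShape.up ℕ).prev 0) = 0 :=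
      P.complex.shape _ _ (by simp)
    simp only [hd, Limits.zero_comp, exists_const]
    rw [← P.extEquivCohomologyClass.apply_eq_iff_eq, P.extEquivCohomologyClass_extMk,
      P.extEquivCohomologyClass_zero, CochainComplex.HomComplex.CohomologyClass.mk_eq_zero_iff,
      CochainComplex.HomComplex.Cocycle.toSingleMk_mem_coboundaries_iff _ _ _ _ _ 1 (by simp)]
    have hz : P.cochainComplex.d (-(0 : ℕ)) 1 = 0 :=
      (P.cochainComplex.isZero_of_isStrictlyLE 0 1).eq_of_tgt _ _
    simp only [hz, Limits.zero_comp, exists_const]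
    rw [← cancel_epi (P.cochainComplexXIso (-(0 : ℕ)) 0 rfl).hom, Limits.comp_zero]

theorem nonempty_homology_linearYonedaObj_addEquiv_ext {C : Type*} [Category* C] [Abelian C]
    [HasExt C] (k : Type*) [Ring k] [Linear k C] {X : C} (P : ProjectiveResolution X) (Y : C)
    (n : ℕ) :
    Nonempty ((P.complex.linearYonedaObj k Y).homology n ≃+ Ext X Y n) := by
  let K := P.complex.linearYonedaObj k Y
  obtain ⟨ι, hι⟩ : ∃ ι : K.cycles n →+ (P.complex.X n ⟶ Y),
      ∀ z, ι z = (K.iCycles n).hom z := ⟨(K.iCycles n).hom.toAddMonoidHom, fun _ ↦ rfl⟩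
  have hcyc (z : K.cycles n) : P.complex.d (n + 1) n ≫ ι z = 0 := by
    rw [hι]
    exact congr($(K.iCycles_d n (n + 1)).hom z)
  have hex : Function.Exact (K.toCycles ((ComplexShape.up ℕ).prev n) n).hom
      (K.homologyπ n).hom :=
    (ShortComplex.ShortExact.moduleCat_exact_iff_function_exact _).1
      (ShortComplex.exact_of_g_is_cokernel (.mk _ _ (K.toCycles_comp_homologyπ _ n))
        (K.homologyIsCokernel _ n rfl))
  have hker : Function.Exact (K.iCycles n).hom (K.d n (n + 1)).hom :=
    (ShortComplex.ShortExact.moduleCat_exact_iff_function_exact _).1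
      (ShortComplex.exact_of_f_is_kernel (.mk _ _ (K.iCycles_d n (n + 1)))
        (K.cyclesIsKernel n (n + 1) (by simp)))
  have hinj : Function.Injective (K.iCycles n).hom :=
    (ModuleCat.mono_iff_injective _).1 inferInstance
  refine AddMonoidHom.nonempty_addEquiv_of_ker_iff (K.homologyπ n).hom.toAddMonoidHom
    { toFun z := P.extMk (ι z) (n + 1) rfl (hcyc z)
      map_zero' := by simp
      map_add' x y := by simp [P.add_extMk] }
    ((ModuleCat.epi_iff_surjective _).1 inferInstance) ?_ (AddEquiv.refl _) fun z ↦ ?_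
  · intro α
    obtain ⟨f, hf, rfl⟩ := P.extMk_surjective α (n + 1) rfl
    obtain ⟨z, hz⟩ := (hker f).1 hf
    exact ⟨z, by simp [hι, hz]⟩
  · refine (hex z).trans (.trans ?_ (P.extMk_eq_zero_iff_exists_d (ι z) (n + 1) rfl (hcyc z)).symm)
    refine exists_congr fun g ↦ ?_
    rw [← hinj.eq_iff, hι]
    exact Eq.congr_left congr($(K.toCycles_i _ n).hom g)

theorem Ext.exists_surjective_of_injective {C : Type*} [Category* C] [Abelian C]
    [HasExt C] {S : ShortComplex C} (hS : S.ShortExact) [Injective S.X₂] (X : C) (n : ℕ) :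
    ∃ φ : Ext X S.X₃ n →+ Ext X S.X₁ (n + 1), Function.Surjective φ ∧
      ∀ x, φ x = 0 ↔ ∃ y : Ext X S.X₂ n, y.comp (Ext.mk₀ S.g) (add_zero n) = x := by
  refine ⟨hS.extClass.postcomp X rfl, fun x ↦ ?_, fun x ↦ ⟨fun h ↦ ?_, ?_⟩⟩
  · exact Ext.covariant_sequence_exact₁ X hS x (Ext.eq_zero_of_injective _) rfl
  · exact Ext.covariant_sequence_exact₃ X hS x rfl h
  · rintro ⟨y, rfl⟩
    simp

/-- Let `F ⊣ G` with `F` preserving monomorphisms, and let `p` be a class of objects such that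
for every short exact sequence `0 ⟶ V ⟶ I ⟶ V' ⟶ 0` with `I` injective and `p V`, the map
`G I ⟶ G V'` is epi and `p V'`. Then `Ext W (G V) n ≃+ Ext (F W) V n` whenever `p V`. -/
theorem Adjunction.nonempty_ext_addEquiv {C D : Type*} [Category* C] [Category* D]
    [Abelian C] [Abelian D] [HasExt C] [HasExt D] [EnoughInjectives C] {F : D ⥤ C} {G : C ⥤ D}
    [F.PreservesMonomorphisms] [F.Additive] (adj : F ⊣ G) (p : C → Prop)
    (hp : ∀ S : ShortComplex C, S.ShortExact → Injective S.X₂ → p S.X₁ →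
      p S.X₃ ∧ Epi (G.map S.g))
    (W : D) (n : ℕ) (V : C) (hV : p V) :
    Nonempty (Ext W (G.obj V) n ≃+ Ext (F.obj W) V n) := by
  have : G.Additive := adj.right_adjoint_additive
  have : Limits.PreservesLimitsOfSize.{0, 0} G := adj.rightAdjoint_preservesLimits
  have : G.PreservesInjectiveObjects :=
    Functor.preservesInjectiveObjects_of_adjunction_of_preservesMonomorphisms adj
  induction n generalizing V with
  | zero =>
    exact ⟨Ext.addEquiv₀.trans ((adj.homAddEquiv W V).symm.trans Ext.addEquiv₀.symm)⟩
  | succ n ih =>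
    let S : ShortComplex C := .mk (Injective.ι V) (Limits.cokernel.π (Injective.ι V)) (by simp)
    have hS : S.ShortExact :=
      { exact := ShortComplex.exact_of_g_is_cokernel _ (Limits.cokernelIsCokernel _)
        mono_f := inferInstanceAs (Mono (Injective.ι V))
        epi_g := inferInstanceAs (Epi (Limits.cokernel.π (Injective.ι V))) }
    have hI : Injective S.X₂ := inferInstanceAs (Injective (Injective.under V))
    obtain ⟨h₃, hepi⟩ := hp S hS hI hV
    have hGS : (S.map G).ShortExact :=
      have := hS.mono_f
      { exact := hS.exact.map_of_mono_of_preservesKernel G inferInstance inferInstance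
        mono_f := inferInstanceAs (Mono (G.map S.f))
        epi_g := hepi }
    have : Injective (S.map G).X₂ := inferInstanceAs (Injective (G.obj S.X₂))
    obtain ⟨φ, hφ, hφ'⟩ : ∃ φ : Ext W (G.obj S.X₃) n →+ Ext W (G.obj V) (n + 1),
        Function.Surjective φ ∧ ∀ x, φ x = 0 ↔ ∃ y : Ext W (G.obj S.X₂) n,
          y.comp (Ext.mk₀ (G.map S.g)) (add_zero n) = x :=
      Ext.exists_surjective_of_injective hGS W n
    obtain ⟨ψ, hψ, hψ'⟩ := Ext.exists_surjective_of_injective hS (F.obj W) n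
    cases n with
    | zero =>
      refine φ.nonempty_addEquiv_of_ker_iff ψ hφ hψ
        (Ext.addEquiv₀.trans ((adj.homAddEquiv W S.X₃).symm.trans Ext.addEquiv₀.symm))
        fun x ↦ ?_
      obtain ⟨x, rfl⟩ := Ext.addEquiv₀.symm.surjective x
      rw [hφ', hψ', Ext.addEquiv₀.symm.surjective.exists, Ext.addEquiv₀.symm.surjective.exists,
        (adj.homAddEquiv W S.X₂).surjective.exists]
      refine exists_congr fun y ↦ ?_
      simp only [AddEquiv.trans_apply, Ext.addEquiv₀_symm_apply, Ext.mk₀_comp_mk₀]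
      rw [Ext.mk₀_bijective _ _ |>.injective.eq_iff, Ext.mk₀_bijective _ _ |>.injective.eq_iff]
      have hx : Ext.addEquiv₀ (Ext.mk₀ x) = x := Ext.addEquiv₀.apply_symm_apply x
      simp [Adjunction.homAddEquiv, ← adj.homEquiv_naturality_right, Equiv.eq_symm_apply, hx]
    | succ n =>
      obtain ⟨e⟩ := ih _ h₃
      refine φ.nonempty_addEquiv_of_ker_iff ψ hφ hψ e fun x ↦ ?_
      have h1 (y : Ext W (G.obj S.X₂) (n + 1)) : y = 0 := Ext.eq_zero_of_injective _
      have h2 (y : Ext (F.obj W) S.X₂ (n + 1)) : y = 0 := Ext.eq_zero_of_injective _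
      have h3 : φ x = 0 ↔ x = 0 := by
        rw [hφ']
        exact ⟨fun ⟨y, hy⟩ ↦ by rw [← hy, h1 y]; simp, fun h ↦ ⟨0, by simp [h]⟩⟩
      have h4 : ψ (e x) = 0 ↔ e x = 0 := by
        rw [hψ']
        exact ⟨fun ⟨y, hy⟩ ↦ by rw [← hy, h2 y]; simp, fun h ↦ ⟨0, by simp [h]⟩⟩
      rw [h3, h4, map_eq_zero_iff e e.injective]

/-- Isomorphisms `X ≅ X'` and `Y ≅ Y'` induce an isomorphism between the `Ext`-groups. -/
noncomputable def Ext.addEquivOfIso {C : Type*} [Category* C] [Abelian C] [HasExt C]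
    {X X' Y Y' : C} (e : X ≅ X') (e' : Y ≅ Y') (n : ℕ) : Ext X Y n ≃+ Ext X' Y' n where
  toFun α := (Ext.mk₀ e.inv).comp (α.comp (Ext.mk₀ e'.hom) (add_zero n)) (zero_add n)
  invFun α := (Ext.mk₀ e.hom).comp (α.comp (Ext.mk₀ e'.inv) (add_zero n)) (zero_add n)
  left_inv α := by
    dsimp only
    rw [Ext.comp_assoc_of_third_deg_zero, Ext.comp_assoc_of_third_deg_zero]
    simp
  right_inv α := by
    dsimp only
    rw [Ext.comp_assoc_of_third_deg_zero, Ext.comp_assoc_of_third_deg_zero]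
    simp
  map_add' α β := by simp

end CategoryTheory

namespace Rep

universe u v w

section

variable {k G : Type u} [CommRing k] [Group G]

/-- The embedding of a representation `A` into the representation coinduced from the trivial
subgroup, sending `a` to the function `g ↦ g • a`. -/
noncomputable def toCoindBot (A : Rep.{u} k G) :
    A ⟶ coind (⊥ : Subgroup G).subtype (res (⊥ : Subgroup G).subtype A) :=
  ofHom
    { toFun a := ⟨fun g ↦ A.ρ g a, fun h g ↦ by simp⟩
      map_add' a b := by ext; simp
      map_smul' c a := by ext; simp
      isIntertwining' g := by
        ext a x
        exact congr($((A.ρ.map_mul x g).symm) a) }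

theorem toCoindBot_apply_coe (A : Rep.{u} k G) (a : A) (g : G) :
    ((toCoindBot A).hom a).1 g = A.ρ g a := rfl

instance (A : Rep.{u} k G) : Mono (toCoindBot A) := by
  refine (Rep.mono_iff_injective _).2 fun a b h ↦ ?_
  have h1 := congrFun (congrArg Subtype.val h) 1
  rwa [toCoindBot_apply_coe, toCoindBot_apply_coe, map_one] at h1

/-- Extend a function on a subgroup `N` to a function on `G` using coset representatives and the
action of `G` on the target. -/
noncomputable def coindBotToRes (N : Subgroup G) (A : Rep.{u} k G) :
    coind (⊥ : Subgroup N).subtype (res (⊥ : Subgroup N).subtype (res N.subtype A)) ⟶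
      res N.subtype (coind (⊥ : Subgroup G).subtype (res (⊥ : Subgroup G).subtype A)) :=
  ofHom
    { toFun f := ⟨fun g ↦ A.ρ (g : G ⧸ N).out (f.1 ⟨(g : G ⧸ N).out⁻¹ * g,
          QuotientGroup.eq.1 (QuotientGroup.out_eq' _)⟩),
        fun ⟨h, hh⟩ g ↦ by
          obtain rfl : h = 1 := hh
          simp⟩
      map_add' a b := by ext; simp
      map_smul' c a := by ext; simp
      isIntertwining' n := by
        ext f g
        have h : ((g * n : G) : G ⧸ N) = g := by simp
        change A.ρ (g : G ⧸ N).out (f.1 (_ * n)) =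
          A.ρ ((g * n : G) : G ⧸ N).out (f.1 ⟨((g * n : G) : G ⧸ N).out⁻¹ * (g * n), _⟩)
        congr! 3
        · exact h.symm
        · ext
          simp [h, mul_assoc] }

theorem toCoindBot_comp_coindBotToRes (N : Subgroup G) (A : Rep.{u} k G) :
    toCoindBot (res N.subtype A) ≫ coindBotToRes N A =
      (resFunctor N.subtype).map (toCoindBot A) := by
  ext a g
  change A.ρ (g : G ⧸ N).out (A.ρ ((g : G ⧸ N).out⁻¹ * g) a) = A.ρ g a
  rw [← Module.End.mul_apply, ← map_mul, mul_inv_cancel_left]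

theorem isZero_groupCohomology_res_of_injective (N : Subgroup G) (I : Rep.{u} k G) [Injective I]
    (n : ℕ) : Limits.IsZero (groupCohomology (res N.subtype I) (n + 1)) := by
  have h : toCoindBot (res N.subtype I) ≫ coindBotToRes N I ≫
      (resFunctor N.subtype).map (Injective.factorThru (𝟙 I) (toCoindBot I)) = 𝟙 _ := by
    rw [← Category.assoc, toCoindBot_comp_coindBotToRes, ← Functor.map_comp,
      Injective.comp_factorThru, CategoryTheory.Functor.map_id]
  have hz : Limits.IsZero ((groupCohomology.functor k N (n + 1)).obj
      (coind (⊥ : Subgroup N).subtype (res (⊥ : Subgroup N).subtype (res N.subtype I)))) :=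
    (isZero_groupCohomology_succ_of_subsingleton _ n).of_iso (groupCohomology.coindIso _ _)
  have h' := congrArg (groupCohomology.functor k N (n + 1)).map h
  rw [Functor.map_comp, hz.eq_zero_of_tgt ((groupCohomology.functor k N (n + 1)).map _),
    Limits.zero_comp, CategoryTheory.Functor.map_id] at h'
  exact (Limits.IsZero.iff_id_eq_zero _).2 h'.symm

variable (N : Subgroup G)

theorem isZero_groupCohomology_res_X₃ {S : ShortComplex (Rep.{u} k G)} (hS : S.ShortExact)
    [Injective S.X₂]
    (h : ∀ j, 1 ≤ j → Limits.IsZero (groupCohomology (res N.subtype S.X₁) j)) (j : ℕ)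
    (hj : 1 ≤ j) : Limits.IsZero (groupCohomology (res N.subtype S.X₃) j) := by
  obtain ⟨j, rfl⟩ := Nat.exists_eq_add_of_le' hj
  exact (groupCohomology.mapShortComplex₃_exact
    ((shortExact_res N.subtype).2 hS) rfl).isZero_of_both_zeros
    ((isZero_groupCohomology_res_of_injective N S.X₂ j).eq_zero_of_src _)
    ((h _ (by omega)).eq_zero_of_tgt _)

variable [N.Normal]

theorem epi_quotientToInvariantsFunctor_map {S : ShortComplex (Rep.{u} k G)} (hS : S.ShortExact)
    (h : Limits.IsZero (groupCohomology (res N.subtype S.X₁) 1)) :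
    Epi ((quotientToInvariantsFunctor k N).map S.g) := by
  have := hS.epi_g
  have := hS.mono_f
  have hex : Function.Exact S.f.hom S.g.hom :=
    (ShortComplex.ShortExact.moduleCat_exact_iff_function_exact _).1
      (hS.exact.map (forget₂ (Rep k G) (ModuleCat k)))
  refine (Rep.epi_iff_surjective _).2 fun ⟨y, hy⟩ ↦ ?_
  obtain ⟨x, rfl⟩ := (Rep.epi_iff_surjective S.g).1 inferInstance y
  have hx (n : N) : S.g.hom (S.X₂.ρ n x - x) = 0 := by
    rw [map_sub, hom_comm_apply, sub_eq_zero]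
    exact hy n
  choose c hc using fun n ↦ (hex _).1 (hx n)
  have hcoc : c ∈ groupCohomology.cocycles₁ (res N.subtype S.X₁) := by
    refine (groupCohomology.mem_cocycles₁_iff _).2 fun m n ↦
      (Rep.mono_iff_injective S.f).1 inferInstance ?_
    simp [hc, hom_comm_apply]
  obtain ⟨z, hz⟩ : c ∈ groupCohomology.coboundaries₁ (res N.subtype S.X₁) :=
    (groupCohomology.H1π_eq_zero_iff ⟨c, hcoc⟩).1
      (congr($(h.eq_zero_of_tgt (groupCohomology.H1π _)).hom _))
  refine ⟨⟨x - S.f.hom z, fun n ↦ ?_⟩, ?_⟩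
  · have hn : S.X₁.ρ n z - z = c n := congrFun hz n
    have := hc n
    rw [← hn, map_sub, hom_comm_apply] at this
    rw [MonoidHom.comp_apply, map_sub, sub_eq_sub_iff_sub_eq_sub]
    exact this.symm
  · refine Subtype.ext ?_
    change S.g.hom (x - S.f.hom z) = S.g.hom x
    rw [map_sub, (hex _).2 ⟨z, rfl⟩, sub_zero]

end

section

variable (k : Type u) {G : Type v} [CommRing k] [Group G] (N : Subgroup G) [N.Normal]

/-- Inflation along `G ⟶ G ⧸ N` is left adjoint to taking `N`-invariants. -/
noncomputable def resQuotientToInvariantsAdjunction :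
    resFunctor (QuotientGroup.mk' N) ⊣ quotientToInvariantsFunctor.{w} k N :=
  Adjunction.mkOfHomEquiv
    { homEquiv A B :=
        { toFun f := ofHom
            ⟨f.hom.toLinearMap.codRestrict _ fun a n ↦ by
              have hn : ((n : G) : G ⧸ N) = 1 := (QuotientGroup.eq_one_iff _).2 n.2
              have := hom_comm_apply f n a
              simp [hn] at this
              exact this.symm,
            fun g ↦ QuotientGroup.induction_on g fun g ↦ by
              ext a
              exact hom_comm_apply f g a⟩
          invFun f := ofHom ⟨Submodule.subtype _ ∘ₗ f.hom.toLinearMap, fun g ↦ by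
            ext a
            exact congrArg Subtype.val (hom_comm_apply f g a)⟩
          left_inv f := rfl
          right_inv f := rfl }
      homEquiv_naturality_left_symm f g := rfl
      homEquiv_naturality_right f g := rfl }

/-- The adjunction between inflation along `G ⟶ G ⧸ N` and `N`-invariants, in terms of modules over
the group algebras. -/
noncomputable def moduleInflationInvariantsAdjunction :
    (ofModuleMonoidAlgebra ⋙ resFunctor (QuotientGroup.mk' N)) ⋙ toModuleMonoidAlgebra ⊣
      ofModuleMonoidAlgebra ⋙ quotientToInvariantsFunctor k N ⋙
        toModuleMonoidAlgebra :=
  (equivalenceModuleMonoidAlgebra.symm.toAdjunction.comp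
    (resQuotientToInvariantsAdjunction k N)).comp equivalenceModuleMonoidAlgebra.toAdjunction

end

section

variable (k G : Type u) [CommRing k] [Group G]

instance : (toModuleMonoidAlgebra (k := k) (G := G) : Rep.{u} k G ⥤ _).Additive where
  map_add := rfl

instance : (ofModuleMonoidAlgebra (k := k) (G := G) : _ ⥤ Rep.{u} k G).Additive :=
  have : (equivalenceModuleMonoidAlgebra (k := k) (G := G)).functor.Additive :=
    inferInstanceAs toModuleMonoidAlgebra.Additive
  equivalenceModuleMonoidAlgebra.inverse_additive

end

end Rep

theorem nonempty_ext_addEquiv_of_isZero_groupCohomology {R Γ : Type} [CommRing R] [Group Γ]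
    (N : Subgroup Γ) [N.Normal] (V : Rep.{0} R Γ)
    (hV : ∀ j, 1 ≤ j → Limits.IsZero (groupCohomology (Rep.res N.subtype V) j))
    (W : Rep.{0} R (Γ ⧸ N)) (n : ℕ) :
    Nonempty (Abelian.Ext (ModuleCat.of (MonoidAlgebra R (Γ ⧸ N)) W.ρ.asModule)
        (ModuleCat.of _ (V.ρ.quotientToInvariants N).asModule) n ≃+
      Abelian.Ext (ModuleCat.of (MonoidAlgebra R Γ)
        (Representation.asModule (W.ρ.comp (QuotientGroup.mk' N))))
        (ModuleCat.of _ V.ρ.asModule) n) := by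
  let p (M : ModuleCat (MonoidAlgebra R Γ)) : Prop := ∀ j, 1 ≤ j →
    Limits.IsZero (groupCohomology (Rep.res N.subtype (Rep.ofModuleMonoidAlgebra.obj M)) j)
  have hp (S : ShortComplex (ModuleCat (MonoidAlgebra R Γ))) (hS : S.ShortExact)
      (hI : Injective S.X₂) (h : p S.X₁) : p S.X₃ ∧
        Epi ((Rep.ofModuleMonoidAlgebra ⋙ Rep.quotientToInvariantsFunctor R N ⋙
          Rep.toModuleMonoidAlgebra).map S.g) := by
    have hS' := hS.map_of_exact Rep.ofModuleMonoidAlgebra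
    have : Injective (S.map Rep.ofModuleMonoidAlgebra).X₂ :=
      (Rep.equivalenceModuleMonoidAlgebra.symm.map_injective_iff S.X₂).2 hI
    refine ⟨Rep.isZero_groupCohomology_res_X₃ N hS' h, ?_⟩
    have := Rep.epi_quotientToInvariantsFunctor_map N hS' (h 1 le_rfl)
    exact inferInstanceAs (Epi (Rep.toModuleMonoidAlgebra.map
      ((Rep.quotientToInvariantsFunctor R N).map (S.map Rep.ofModuleMonoidAlgebra).g)))
  let eV : V ≅ Rep.ofModuleMonoidAlgebra.obj (Rep.toModuleMonoidAlgebra.obj V) :=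
    Rep.equivalenceModuleMonoidAlgebra.unitIso.app V
  let eW : W ≅ Rep.ofModuleMonoidAlgebra.obj (Rep.toModuleMonoidAlgebra.obj W) :=
    Rep.equivalenceModuleMonoidAlgebra.unitIso.app W
  obtain ⟨e⟩ := (Rep.moduleInflationInvariantsAdjunction R N).nonempty_ext_addEquiv p hp
    (Rep.toModuleMonoidAlgebra.obj W) n (Rep.toModuleMonoidAlgebra.obj V) fun j hj ↦
      (hV j hj).of_iso ((groupCohomology.functor R N j).mapIso
        ((Rep.resFunctor N.subtype).mapIso eV.symm))
  let e₁ := (Rep.quotientToInvariantsFunctor R N ⋙ Rep.toModuleMonoidAlgebra).mapIso eV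
  let e₂ := (Rep.resFunctor (QuotientGroup.mk' N) ⋙ Rep.toModuleMonoidAlgebra).mapIso eW
  exact ⟨(Ext.addEquivOfIso (Iso.refl _) e₁ n).trans
    (e.trans (Ext.addEquivOfIso e₂.symm (Iso.refl _) n))⟩

/-- Let `R` be a commutative ring, `Γ` a group, `N ⊴ Γ`, and `V` a left
`R[Γ]`-module (given by a representation `ρ : Γ →* (V →ₗ[R] V)`, with associated
`R[Γ]`-module `ρ.asModule`) such that the group cohomology `H^j(N, V)` vanishes for all
`j ≥ 1`.  Let `σ` be the induced representation of `Γ/N` on the invariants `V^N`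
(expressed by the compatibility hypothesis `hσ`).  Then for every left `R[Γ/N]`-module `W`
(given by a representation `τ`) and every `i ≥ 0` there is an isomorphism
`Ext^i_{R[Γ/N]}(W, V^N) ≅ Ext^i_{R[Γ]}(W, V)`, where on the right-hand side `W` is viewed
as an `R[Γ]`-module via inflation along `Γ → Γ/N`. -/
theorem stmt9 (R : Type) [CommRing R] (Γ : Type) [Group Γ] (N : Subgroup Γ) [N.Normal]
    (V : Type) [AddCommGroup V] [Module R V] (ρ : Representation R Γ V)
    (hvan : ∀ j : ℕ, 1 ≤ j →
      Limits.IsZero (groupCohomology (Rep.of (ρ.comp N.subtype)) j))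
    (σ : Representation R (Γ ⧸ N) (Representation.invariants (ρ.comp N.subtype)))
    (hσ : ∀ (γ : Γ) (x : Representation.invariants (ρ.comp N.subtype)),
      (↑(σ (QuotientGroup.mk γ) x) : V) = ρ γ (↑x : V))
    (W : Type) [AddCommGroup W] [Module R W] (τ : Representation R (Γ ⧸ N) W)
    (i : ℕ) :
    Nonempty
      (((Ext ℤ (ModuleCat (MonoidAlgebra R (Γ ⧸ N))) i).obj
          (Opposite.op (ModuleCat.of _ τ.asModule))).obj
            (ModuleCat.of _ σ.asModule) ≅
        ((Ext ℤ (ModuleCat (MonoidAlgebra R Γ)) i).obj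
          (Opposite.op (ModuleCat.of _ (Representation.asModule (τ.comp (QuotientGroup.mk' N)))))).obj
            (ModuleCat.of _ ρ.asModule)) := by
  obtain rfl : σ = ρ.quotientToInvariants N := by
    ext γ x
    exact hσ γ x
  obtain ⟨e⟩ := nonempty_ext_addEquiv_of_isZero_groupCohomology N (Rep.of ρ) hvan (Rep.of τ) i
  let P := projectiveResolution (ModuleCat.of (MonoidAlgebra R (Γ ⧸ N)) τ.asModule)
  let Q := projectiveResolution (ModuleCat.of (MonoidAlgebra R Γ)
    (Representation.asModule (τ.comp (QuotientGroup.mk' N))))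
  obtain ⟨e₁⟩ := nonempty_homology_linearYonedaObj_addEquiv_ext ℤ P
    (ModuleCat.of _ (ρ.quotientToInvariants N).asModule) i
  obtain ⟨e₂⟩ := nonempty_homology_linearYonedaObj_addEquiv_ext ℤ Q
    (ModuleCat.of _ ρ.asModule) i
  exact ⟨P.isoExt i _ ≪≫ (e₁.trans (e.trans e₂.symm)).toIntLinearEquiv.toModuleIso ≪≫
    (Q.isoExt i _).symm⟩
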